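/- Given C > 0 and ε > 0 there is some δ > 0 such that: for any smooth (C^∞) function A : ℝ → M₂(ℝ) with tr A(t) = 0 and ‖A(t)‖ ≤ C for all t ∈ ℝ, and any matrix S ∈ M₂(ℝ) with det S = 1 and ‖S − I‖ ≤ δ, there exists a smooth function B : ℝ → M₂(ℝ) with tr B(t) = 0 for all t, such that: (1) ‖A(t) − B(t)‖ ≤ ε for all t ∈ ℝ; (2) A(t) = B(t) for all t ∉ (0,1); and (3) Φ_B(1) = S·Φ_A(1), where Φ_A and Φ_B denote the fundamental solutions of the linear equations u' = A(t)u and u' = B(t)u respectively. -/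

import Mathlib

open Set

/-- The Euclidean plane. -/
abbrev E2 : Type := EuclideanSpace ℝ (Fin 2)

/-- Continuous linear endomorphisms of the Euclidean plane
(2×2 real matrices with the operator norm). -/
abbrev M2 : Type := E2 →L[ℝ] E2

/-- The trace of a 2×2 real matrix. -/
noncomputable def trM2 (T : M2) : ℝ := LinearMap.trace ℝ E2 (T : E2 →ₗ[ℝ] E2)

/-- The determinant of a 2×2 real matrix. -/
noncomputable def detM2 (T : M2) : ℝ := LinearMap.det (T : E2 →ₗ[ℝ] E2)

theorem aux_zero_smul (X : M2) : (0 : ℝ) • X = 0 := by ext; simp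

theorem aux_neg_cancel (a b c : M2) : -(a * b) * c + a * (b * c) = 0 := by ext; simp

instance auxTower : IsScalarTower ℝ M2 M2 := ⟨fun c x y => by ext; simp⟩

instance auxComm : SMulCommClass ℝ M2 M2 := ⟨fun c x y => by ext; simp⟩

theorem aux_surj (T : M2) : ∃ N, T = Matrix.toEuclideanCLM (n := Fin 2) (𝕜 := ℝ) N :=
  ⟨(Matrix.toEuclideanCLM (n := Fin 2) (𝕜 := ℝ)).symm T,
    (StarAlgEquiv.apply_symm_apply _ T).symm⟩

theorem aux_trM2_eq (T : M2) :
    trM2 T = ((Matrix.toEuclideanCLM (n := Fin 2) (𝕜 := ℝ)).symm T).trace := by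
  obtain ⟨N, rfl⟩ := aux_surj T
  rw [StarAlgEquiv.symm_apply_apply]
  unfold trM2
  rw [LinearMap.trace_eq_matrix_trace ℝ (EuclideanSpace.basisFun (Fin 2) ℝ).toBasis]
  congr 1
  ext i j
  simp [LinearMap.toMatrix_apply]

theorem aux_detM2_eq (T : M2) :
    detM2 T = ((Matrix.toEuclideanCLM (n := Fin 2) (𝕜 := ℝ)).symm T).det := by
  obtain ⟨N, rfl⟩ := aux_surj T
  rw [StarAlgEquiv.symm_apply_apply]
  unfold detM2
  rw [← LinearMap.det_toMatrix (EuclideanSpace.basisFun (Fin 2) ℝ).toBasis]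
  congr 1
  ext i j
  simp [LinearMap.toMatrix_apply]

theorem aux_cayley (T : M2) : T * T = trM2 T • T - detM2 T • (1 : M2) := by
  rw [aux_trM2_eq, aux_detM2_eq]
  obtain ⟨N, rfl⟩ := aux_surj T
  rw [StarAlgEquiv.symm_apply_apply, ← map_mul, ← map_smul,
    ← map_one (Matrix.toEuclideanCLM (n := Fin 2) (𝕜 := ℝ)), ← map_smul, ← map_sub]
  congr 1
  ext i j
  fin_cases i <;> fin_cases j <;>
    simp [Matrix.mul_apply, Fin.sum_univ_two, Matrix.trace_fin_two, Matrix.det_fin_two] <;> ring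

theorem aux_polar (U T : M2) (hU : trM2 U = 0) :
    trM2 (U * T) • (1 : M2) = U * T + T * U - trM2 T • U := by
  rw [aux_trM2_eq] at hU ⊢
  rw [aux_trM2_eq T]
  obtain ⟨N, rfl⟩ := aux_surj T
  obtain ⟨L, rfl⟩ := aux_surj U
  rw [StarAlgEquiv.symm_apply_apply] at hU
  rw [← map_mul, ← map_mul, StarAlgEquiv.symm_apply_apply, StarAlgEquiv.symm_apply_apply,
    ← map_smul,
    ← map_one (Matrix.toEuclideanCLM (n := Fin 2) (𝕜 := ℝ)), ← map_smul, ← map_add, ← map_sub]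
  congr 1
  rw [Matrix.trace_fin_two] at hU
  have h1 : L 1 1 = - L 0 0 := by linarith
  ext i j
  fin_cases i <;> fin_cases j <;>
    simp [Matrix.mul_apply, Fin.sum_univ_two, Matrix.trace_fin_two, h1] <;> ring

/-- trace as a continuous linear map -/
noncomputable def auxTr : M2 →L[ℝ] ℝ :=
  LinearMap.toContinuousLinearMap
    ({ toFun := trM2
       map_add' := fun x y => by simp [trM2]
       map_smul' := fun c x => by simp [trM2] } : M2 →ₗ[ℝ] ℝ)

theorem auxTr_apply (T : M2) : auxTr T = trM2 T := rfl

theorem auxTr_one : auxTr 1 = 2 := by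
  rw [auxTr_apply, aux_trM2_eq, map_one]; simp

theorem auxTr_comm (S T : M2) : auxTr (S * T) = auxTr (T * S) := by
  rw [auxTr_apply, auxTr_apply]
  exact LinearMap.trace_mul_comm ℝ (S : E2 →ₗ[ℝ] E2) (T : E2 →ₗ[ℝ] E2)

/-- adjugate -/
noncomputable def auxAdj : M2 →L[ℝ] M2 :=
  auxTr.smulRight (1 : M2) - ContinuousLinearMap.id ℝ M2

theorem auxAdj_apply (T : M2) : auxAdj T = auxTr T • (1 : M2) - T := rfl

theorem auxAdj_mul (U T : M2) (hU : trM2 U = 0) : auxAdj (U * T) = - (auxAdj T * U) := by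
  rw [auxAdj_apply, auxAdj_apply, auxTr_apply, aux_polar U T hU, auxTr_apply, sub_mul,
    smul_mul_assoc, one_mul]
  abel

theorem auxAdj_comm (T : M2) : auxAdj T * T = T * auxAdj T := by
  rw [auxAdj_apply, sub_mul, mul_sub, smul_mul_assoc, mul_smul_comm, one_mul, mul_one]

theorem aux_deriv_adj {A Φ : ℝ → M2} (hA : ∀ t, trM2 (A t) = 0)
    (hΦ : ∀ t, HasDerivAt Φ (A t * Φ t) t) (t : ℝ) :
    HasDerivAt (fun s => auxAdj (Φ s)) (-(auxAdj (Φ t) * A t)) t := by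
  rw [← auxAdj_mul _ _ (hA t)]
  exact auxAdj.hasFDerivAt.comp_hasDerivAt t (hΦ t)

theorem aux_adj_mul_self {A Φ : ℝ → M2} (hA : ∀ t, trM2 (A t) = 0) (h0 : Φ 0 = 1)
    (hΦ : ∀ t, HasDerivAt Φ (A t * Φ t) t) (t : ℝ) : auxAdj (Φ t) * Φ t = 1 := by
  have hd : ∀ s, HasDerivAt (fun s => auxAdj (Φ s) * Φ s) 0 s := by
    intro s
    have := (aux_deriv_adj hA hΦ s).mul (hΦ s)
    refine HasDerivAt.congr_deriv this ?_
    exact aux_neg_cancel _ _ _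
  have hc := is_const_of_deriv_eq_zero (f := fun s => auxAdj (Φ s) * Φ s)
    (fun s => (hd s).differentiableAt) (fun s => (hd s).deriv) t 0
  rw [hc, h0, auxAdj_apply, auxTr_one, mul_one]
  module

theorem aux_gron {F F' : ℝ → M2} {C : ℝ} (h0 : ‖F 0‖ ≤ 1)
    (hF : ∀ t, HasDerivAt F (F' t) t) (hb : ∀ t, ‖F' t‖ ≤ C * ‖F t‖) (hC : 0 < C)
    (t : ℝ) (ht : t ∈ Set.Icc (0 : ℝ) 1) : ‖F t‖ ≤ Real.exp C := by
  have := norm_le_gronwallBound_of_norm_deriv_right_le (f := F) (f' := F') (δ := 1) (K := C)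
    (ε := 0) (a := 0) (b := 1) (fun s _ => (hF s).continuousAt.continuousWithinAt)
    (fun s _ => (hF s).hasDerivWithinAt) h0 (fun s _ => by simpa using hb s) t ht
  rw [gronwallBound_ε0] at this
  refine this.trans ?_
  rw [one_mul, Real.exp_le_exp]
  nlinarith [ht.1, ht.2]

theorem aux_smooth {A Φ : ℝ → M2} (hA : ContDiff ℝ (⊤ : ℕ∞) A)
    (hΦ : ∀ t, HasDerivAt Φ (A t * Φ t) t) : ContDiff ℝ (⊤ : ℕ∞) Φ := by
  rw [contDiff_infty]
  intro n
  induction n with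
  | zero =>
    rw [Nat.cast_zero, contDiff_zero]
    exact continuous_iff_continuousAt.2 fun t => (hΦ t).continuousAt
  | succ n ih =>
    rw [Nat.cast_succ, contDiff_succ_iff_deriv]
    refine ⟨fun t => (hΦ t).differentiableAt, by simp, ?_⟩
    have : deriv Φ = fun t => A t * Φ t := funext fun t => (hΦ t).deriv
    rw [this]
    exact ((contDiff_infty.1 hA) n).mul ih

theorem aux_sigma_deriv (t : ℝ) (ht : t ∉ Set.Ioo (0 : ℝ) 1) :
    deriv Real.smoothTransition t = 0 := by
  by_cases h : t ≤ 0
  · apply IsLocalMin.deriv_eq_zero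
    refine Filter.Eventually.of_forall fun s => ?_
    rw [Real.smoothTransition.zero_of_nonpos h]
    exact Real.smoothTransition.nonneg s
  · have h1 : 1 ≤ t := by
      by_contra h2
      exact ht ⟨not_le.1 h, not_le.1 h2⟩
    apply IsLocalMax.deriv_eq_zero
    refine Filter.Eventually.of_forall fun s => ?_
    rw [Real.smoothTransition.one_of_one_le h1]
    exact Real.smoothTransition.le_one s

theorem aux_sigma_smooth : ContDiff ℝ (⊤ : ℕ∞) (deriv Real.smoothTransition) := by
  have h : ContDiff ℝ (⊤ : ℕ∞) Real.smoothTransition := Real.smoothTransition.contDiff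
  exact (contDiff_infty_iff_deriv.1 h).2

theorem aux_sigma_bound : ∃ M : ℝ, 0 < M ∧ ∀ t, |deriv Real.smoothTransition t| ≤ M := by
  obtain ⟨M, hM⟩ := (isCompact_Icc (a := (0 : ℝ)) (b := 1)).exists_bound_of_continuousOn
    (aux_sigma_smooth.continuous.continuousOn)
  refine ⟨max M 1, by positivity, fun t => ?_⟩
  by_cases ht : t ∈ Set.Ioo (0 : ℝ) 1
  · exact (hM t (Set.Ioo_subset_Icc_self ht)).trans (le_max_left _ _)
  · rw [aux_sigma_deriv t ht, abs_zero]; positivity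

/-- the determinant of `1 + s X` -/
noncomputable def auxD (τ : ℝ) (t : ℝ) : ℝ :=
  1 + Real.smoothTransition t * (1 - Real.smoothTransition t) * τ

theorem auxD_ge {τ : ℝ} (hτ : |τ| ≤ 1 / 2) (t : ℝ) : 1 / 2 ≤ auxD τ t := by
  unfold auxD
  have h0 := Real.smoothTransition.nonneg t
  have h1 := Real.smoothTransition.le_one t
  set s := Real.smoothTransition t
  have h2 : 0 ≤ s * (1 - s) := mul_nonneg h0 (by linarith)
  have h3 : s * (1 - s) ≤ 1 := by nlinarith
  have := (abs_le.1 hτ).1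
  nlinarith

theorem auxD_smooth (τ : ℝ) : ContDiff ℝ (⊤ : ℕ∞) (auxD τ) := by
  have h : ContDiff ℝ (⊤ : ℕ∞) Real.smoothTransition := Real.smoothTransition.contDiff
  unfold auxD
  fun_prop

/-- the path -/
noncomputable def auxP (X : M2) (t : ℝ) : M2 :=
  (Real.sqrt (auxD (auxTr X) t))⁻¹ • (1 + Real.smoothTransition t • X)

theorem auxP_deriv {X : M2} (hτ : |auxTr X| ≤ 1 / 2)
    (hX : X * X = auxTr X • X + auxTr X • (1 : M2)) (t : ℝ) :
    HasDerivAt (auxP X)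
      (((deriv Real.smoothTransition t / auxD (auxTr X) t) •
        (X - (auxTr X / 2) • (1 : M2))) * auxP X t) t := by
  have hσ : HasDerivAt Real.smoothTransition (deriv Real.smoothTransition t) t := by
    have h : ContDiff ℝ (⊤ : ℕ∞) Real.smoothTransition := Real.smoothTransition.contDiff
    exact ((h.differentiable (by simp)) t).hasDerivAt
  have hDpos : 0 < auxD (auxTr X) t := by linarith [auxD_ge hτ t]
  set τ := auxTr X with hτd
  have hD : HasDerivAt (auxD τ)
      (deriv Real.smoothTransition t * (1 - 2 * Real.smoothTransition t) * τ) t := by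
    have := ((hσ.mul (hσ.const_sub 1)).mul_const τ).const_add 1
    refine HasDerivAt.congr_deriv this ?_
    ring
  have hs := Real.sqrt_pos.2 hDpos
  have hf := (hD.sqrt hDpos.ne').inv hs.ne'
  have hP := hf.smul ((hσ.smul_const X).const_add (1 : M2))
  refine (hP.congr_deriv ?_)
  have hsq := Real.sq_sqrt hDpos.le
  have hDe : auxD τ t = 1 + Real.smoothTransition t * (1 - Real.smoothTransition t) * τ := rfl
  simp only [auxP, ← hτd, Pi.inv_apply]
  generalize deriv Real.smoothTransition t = d at *
  generalize Real.smoothTransition t = s at *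
  generalize auxD τ t = D at *
  have hr : √D ^ 2 = D := hsq
  have e : (X - (τ / 2) • (1 : M2)) * (1 + s • X)
      = (1 + s * τ - s * τ / 2) • X + (s * τ - τ / 2) • (1 : M2) := by
    rw [sub_mul, mul_add, mul_smul_comm, hX, smul_mul_assoc, mul_one, one_mul]
    module
  rw [smul_mul_smul_comm, e]
  generalize √D = r at *
  subst hr
  match_scalars <;> field_simp <;>
    first | (ring1; done) | linear_combination (2 * d) * hDe | linear_combination (-2 * d) * hDe |
      linear_combination d * hDe

/-- Perturbation lemma for traceless linear variational equations (left composition):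
given `C, ε > 0`, there is `δ > 0` such that for any smooth traceless `A : ℝ → M₂(ℝ)`
with `‖A(t)‖ ≤ C`, and any `S ∈ SL(2,ℝ)` with `‖S − I‖ ≤ δ`, there is a smooth
traceless `B` which is `ε`-close to `A`, coincides with `A` outside `(0,1)`, and whose
fundamental solution satisfies `Φ_B(1) = S·Φ_A(1)`. -/
theorem perturbation_lemma_left (C : ℝ) (hC : 0 < C) (ε : ℝ) (hε : 0 < ε) :
    ∃ δ : ℝ, 0 < δ ∧
      ∀ A : ℝ → M2, ContDiff ℝ (⊤ : ℕ∞) A → (∀ t : ℝ, trM2 (A t) = 0) →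
        (∀ t : ℝ, ‖A t‖ ≤ C) →
      ∀ S : M2, detM2 S = 1 → ‖S - 1‖ ≤ δ →
      ∀ ΦA : ℝ → M2, ΦA 0 = 1 → (∀ t : ℝ, HasDerivAt ΦA (A t * ΦA t) t) →
      ∃ B : ℝ → M2, ContDiff ℝ (⊤ : ℕ∞) B ∧ (∀ t : ℝ, trM2 (B t) = 0) ∧
        (∀ t : ℝ, ‖A t - B t‖ ≤ ε) ∧
        (∀ t : ℝ, t ∉ Set.Ioo (0 : ℝ) 1 → A t = B t) ∧
        ∃ ΦB : ℝ → M2, ΦB 0 = 1 ∧ (∀ t : ℝ, HasDerivAt ΦB (B t * ΦB t) t) ∧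
          ΦB 1 = S * ΦA 1 := by
  obtain ⟨M, hM0, hM⟩ := aux_sigma_bound
  set c : ℝ := ‖auxTr‖ with hc
  have hc0 : 0 ≤ c := auxTr.opNorm_nonneg
  set K : ℝ := Real.exp C with hK
  have hK0 : 0 < K := Real.exp_pos C
  set L : ℝ := K * K * (2 * M * (1 + c)) * K * K with hL
  have hL0 : 0 < L := by positivity
  refine ⟨min (1 / (2 * (c + 1))) (ε / L), by positivity, ?_⟩
  intro A hA htr hAC S hS hSδ Φ hΦ0 hΦ
  set X : M2 := S - 1 with hXdef
  have hX1 : ‖X‖ ≤ 1 / (2 * (c + 1)) := hSδ.trans (min_le_left _ _)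
  have hX2 : ‖X‖ ≤ ε / L := hSδ.trans (min_le_right _ _)
  have hτX : |auxTr X| ≤ c * ‖X‖ := auxTr.le_opNorm X
  have hτ : |auxTr X| ≤ 1 / 2 := by
    refine hτX.trans ?_
    rw [le_div_iff₀ (by positivity)] at hX1
    nlinarith [norm_nonneg X]
  have hSX : S = 1 + X := by rw [hXdef]; abel
  have hXX : X * X = auxTr X • X + auxTr X • (1 : M2) := by
    have h := aux_cayley S
    rw [hS, ← auxTr_apply] at h
    have h2 : auxTr S = 2 + auxTr X := by rw [hSX, map_add, auxTr_one]
    rw [h2, hSX, add_mul, mul_add, mul_add, one_mul, mul_one, one_mul] at h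
    have h3 : X * X = (1 + X + (X + X * X)) - (1 + X + X) := by abel
    rw [h3, h]
    module
  set τ := auxTr X with hτd
  set Y : M2 := X - (τ / 2) • (1 : M2) with hY
  have hYn : ‖Y‖ ≤ (1 + c) * ‖X‖ := by
    have h1 : ‖(τ / 2) • (1 : M2)‖ ≤ |τ| := by
      rw [norm_smul, Real.norm_eq_abs, abs_div, abs_two]
      have : ‖(1 : M2)‖ ≤ 1 := ContinuousLinearMap.norm_id_le
      nlinarith [abs_nonneg τ, norm_nonneg (1 : M2)]
    have := norm_sub_le X ((τ / 2) • (1 : M2))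
    rw [hY]
    linarith
  have hYtr : auxTr Y = 0 := by
    rw [hY, map_sub, map_smul, auxTr_one, ← hτd, smul_eq_mul]; ring
  set g : ℝ → ℝ := fun t => deriv Real.smoothTransition t / auxD τ t with hg
  have hgs : ContDiff ℝ (⊤ : ℕ∞) g :=
    aux_sigma_smooth.div (auxD_smooth τ) (fun t => by linarith [auxD_ge hτ t])
  have hgb : ∀ t, |g t| ≤ 2 * M := by
    intro t
    have h := auxD_ge hτ t
    rw [hg]
    simp only
    rw [abs_div, abs_of_pos (by linarith : 0 < auxD τ t), div_le_iff₀ (by linarith)]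
    nlinarith [hM t]
  have hg0 : ∀ t, t ∉ Set.Ioo (0 : ℝ) 1 → g t = 0 := fun t ht => by
    simp only [hg, aux_sigma_deriv t ht, zero_div]
  have hΦs := aux_smooth hA hΦ
  have hadj := aux_adj_mul_self htr hΦ0 hΦ
  have hadj' : ∀ t, Φ t * auxAdj (Φ t) = 1 := fun t => by rw [← auxAdj_comm, hadj]
  have hone : ‖(1 : M2)‖ ≤ 1 := ContinuousLinearMap.norm_id_le
  have hΦb : ∀ t ∈ Set.Icc (0 : ℝ) 1, ‖Φ t‖ ≤ K := fun t ht =>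
    aux_gron (by rw [hΦ0]; exact hone) hΦ
      (fun t => (norm_mul_le _ _).trans (mul_le_mul_of_nonneg_right (hAC t) (norm_nonneg _)))
      hC t ht
  have hadj0 : auxAdj (Φ 0) = 1 := by
    have := hadj 0
    rw [hΦ0, mul_one] at this
    rw [hΦ0, this]
  have hΨb : ∀ t ∈ Set.Icc (0 : ℝ) 1, ‖auxAdj (Φ t)‖ ≤ K := fun t ht =>
    aux_gron (F := fun s => auxAdj (Φ s)) (by
        show ‖auxAdj (Φ 0)‖ ≤ 1
        rw [hadj0]; exact hone) (aux_deriv_adj htr hΦ)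
      (fun t => by
        rw [norm_neg, mul_comm C]
        exact (norm_mul_le _ _).trans (mul_le_mul_of_nonneg_left (hAC t) (norm_nonneg _)))
      hC t ht
  have h1m : (1 : ℝ) ∈ Set.Icc (0 : ℝ) 1 := ⟨zero_le_one, le_rfl⟩
  refine ⟨fun t => A t + Φ t * auxAdj (Φ 1) * (g t • Y) * Φ 1 * auxAdj (Φ t), ?_, ?_, ?_, ?_,
    fun t => Φ t * auxAdj (Φ 1) * auxP X t * Φ 1, ?_, ?_, ?_⟩
  · exact hA.add ((((hΦs.mul contDiff_const).mul (hgs.smul contDiff_const)).mul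
      contDiff_const).mul (auxAdj.contDiff.comp hΦs))
  · intro t
    rw [← auxTr_apply, map_add, auxTr_apply (A t), htr, zero_add, auxTr_comm]
    have e : auxAdj (Φ t) * (Φ t * auxAdj (Φ 1) * (g t • Y) * Φ 1)
        = (auxAdj (Φ t) * Φ t) * (auxAdj (Φ 1) * (g t • Y) * Φ 1) := by
      simp only [mul_assoc]
    rw [e, hadj, one_mul, auxTr_comm, ← mul_assoc, hadj', one_mul, map_smul, hYtr, smul_zero]
  · intro t
    rw [sub_add_cancel_left, norm_neg]
    by_cases ht : t ∈ Set.Ioo (0 : ℝ) 1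
    · have ht' := Set.Ioo_subset_Icc_self ht
      have hgY : ‖g t • Y‖ ≤ 2 * M * ((1 + c) * ‖X‖) := by
        rw [norm_smul]
        exact mul_le_mul (hgb t) hYn (norm_nonneg _) (by positivity)
      have b1 := norm_mul_le_of_le (hΦb t ht') (hΨb 1 h1m)
      have b2 := norm_mul_le_of_le b1 hgY
      have b3 := norm_mul_le_of_le b2 (hΦb 1 h1m)
      have b4 := norm_mul_le_of_le b3 (hΨb t ht')
      refine b4.trans ?_
      rw [le_div_iff₀ hL0] at hX2
      calc _ = ‖X‖ * L := by rw [hL]; ring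
        _ ≤ ε := hX2
    · rw [hg0 t ht, aux_zero_smul, mul_zero, zero_mul, zero_mul, norm_zero]
      exact hε.le
  · intro t ht
    simp only [hg0 t ht, aux_zero_smul, mul_zero, zero_mul, add_zero]
  · have : auxP X 0 = 1 := by
      simp [auxP, auxD, Real.smoothTransition.zero, aux_zero_smul]
    simp only [this, hΦ0, one_mul, mul_one, hadj]
  · intro t
    have hP := auxP_deriv hτ hXX t
    have h := (((hΦ t).mul_const (auxAdj (Φ 1))).mul hP).mul_const (Φ 1)
    refine HasDerivAt.congr_deriv h ?_
    have e : Φ t * auxAdj (Φ 1) * (g t • Y) * Φ 1 * auxAdj (Φ t)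
        * (Φ t * auxAdj (Φ 1) * auxP X t * Φ 1)
        = Φ t * auxAdj (Φ 1) * (g t • Y) * (Φ 1 * ((auxAdj (Φ t)
        * Φ t) * auxAdj (Φ 1))) * auxP X t * Φ 1 := by
      simp only [mul_assoc]
    beta_reduce
    rw [add_mul, add_mul, e, hadj, one_mul, hadj', mul_one]
    simp only [mul_assoc]
    rfl
  · have : auxP X 1 = S := by
      simp [auxP, auxD, Real.smoothTransition.one, hSX]
    simp only [this, hadj', one_mul]
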